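/- arXiv:2111.08432 — 2 statements merged into one kernel-verified Lean document; each statement's English description precedes it below -/
import Mathlib

section
/- Let R, R₁, R₂, R₁₂ form a gluing diagram (0 → R → R₁ ⊕ R₂ → R₁₂ → 0 exact) with R₁, R₂ noetherian and each R_i → R₁₂ flat. If for every finite gluing datum the map M ⊗_R R₁ → M₁ is surjective, then for every finite gluing datum the glued module M = ker(ψ₁ - ψ₂) is a finitely presented R-module and the natural maps M ⊗_R R₁ → M₁ and M ⊗_R R₂ → M₂ are bijective. -/
open TensorProduct

universe u

/-- The glued module `M = ker(ψ₁ - ψ₂ : M₁ ⊕ M₂ → M₁₂)` of a gluing datum,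
as an `R`-submodule of `M₁ × M₂`. -/
noncomputable def glueSubmodule
    (R : Type u) {R1 R2 R12 : Type u} [CommRing R] [CommRing R1] [CommRing R2] [CommRing R12]
    [Algebra R R1] [Algebra R R2] [Algebra R R12] [Algebra R1 R12] [Algebra R2 R12]
    [IsScalarTower R R1 R12] [IsScalarTower R R2 R12]
    {M1 M2 M12 : Type u}
    [AddCommGroup M1] [Module R1 M1] [Module R M1] [IsScalarTower R R1 M1]
    [AddCommGroup M2] [Module R2 M2] [Module R M2] [IsScalarTower R R2 M2]
    [AddCommGroup M12] [Module R12 M12]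
    (ψ1 : (R12 ⊗[R1] M1) ≃ₗ[R12] M12) (ψ2 : (R12 ⊗[R2] M2) ≃ₗ[R12] M12) :
    Submodule R (M1 × M2) where
  carrier := {x : M1 × M2 | ψ1 ((1 : R12) ⊗ₜ[R1] x.1) = ψ2 ((1 : R12) ⊗ₜ[R2] x.2)}
  add_mem' {a b} ha hb := by
    simp only [Set.mem_setOf_eq, Prod.fst_add, Prod.snd_add, TensorProduct.tmul_add,
      map_add] at *
    rw [ha, hb]
  zero_mem' := by simp
  smul_mem' r x hx := by
    have h1 : ψ1 ((1 : R12) ⊗ₜ[R1] (r • x.1)) =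
        algebraMap R R12 r • ψ1 ((1 : R12) ⊗ₜ[R1] x.1) := by
      rw [← algebraMap_smul R1 r x.1, TensorProduct.tmul_smul,
        ← algebraMap_smul R12 (algebraMap R R1 r) ((1 : R12) ⊗ₜ[R1] x.1),
        map_smul, ← IsScalarTower.algebraMap_apply R R1 R12]
    have h2 : ψ2 ((1 : R12) ⊗ₜ[R2] (r • x.2)) =
        algebraMap R R12 r • ψ2 ((1 : R12) ⊗ₜ[R2] x.2) := by
      rw [← algebraMap_smul R2 r x.2, TensorProduct.tmul_smul,
        ← algebraMap_smul R12 (algebraMap R R2 r) ((1 : R12) ⊗ₜ[R2] x.2),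
        map_smul, ← IsScalarTower.algebraMap_apply R R2 R12]
    simp only [Set.mem_setOf_eq, Prod.smul_fst, Prod.smul_snd] at *
    rw [h1, h2, hx]

section BaseChange

/-- For `B` flat over `A`, base change commutes with the kernel of the map `A^ι → P` attached to a
finite family in `P`, up to an identification `φ` of `B ⊗[A] P`. -/
noncomputable def kerLinearCombinationBaseChangeEquiv {A B P Q ι : Type*} [Fintype ι] [CommRing A]
    [CommRing B] [Algebra A B] [Module.Flat A B] [AddCommGroup P] [Module A P] [AddCommGroup Q]
    [Module B Q] (φ : (B ⊗[A] P) ≃ₗ[B] Q) (x : ι → P) (y : ι → Q)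
    (h : ∀ i, φ (1 ⊗ₜ x i) = y i) :
    (B ⊗[A] LinearMap.ker (Fintype.linearCombination A x)) ≃ₗ[B]
      LinearMap.ker (Fintype.linearCombination B y) := by
  classical
  refine (LinearMap.tensorKerEquiv B B (Fintype.linearCombination A x)).trans
    ((TensorProduct.piScalarRight A B B ι).ofSubmodules _ _ ?_)
  have hcomp (t : B ⊗[A] (ι → A)) :
      φ (AlgebraTensorModule.lTensor B B (Fintype.linearCombination A x) t) =
      Fintype.linearCombination B y (TensorProduct.piScalarRight A B B ι t) := by
    induction t with
    | zero => simp
    | add s t hs ht => rw [map_add, map_add, map_add, map_add, hs, ht]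
    | tmul b v =>
      simp only [AlgebraTensorModule.lTensor_tmul,
        Fintype.linearCombination_apply, TensorProduct.piScalarRight_apply,
        TensorProduct.piScalarRightHom_tmul, TensorProduct.tmul_sum, map_sum]
      refine Finset.sum_congr rfl fun i _ => ?_
      rw [← h, ← map_smul, TensorProduct.smul_tmul', smul_eq_mul, mul_one,
        TensorProduct.smul_tmul]
  rw [Submodule.map_equiv_eq_comap_symm]
  ext v
  obtain ⟨t, rfl⟩ := (TensorProduct.piScalarRight A B B ι).surjective v
  rw [Submodule.mem_comap, LinearMap.mem_ker, LinearMap.mem_ker, ← hcomp, LinearEquiv.coe_coe,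
    LinearEquiv.symm_apply_apply, LinearEquiv.map_eq_zero_iff]

theorem coe_kerLinearCombinationBaseChangeEquiv_one_tmul {A B P Q ι : Type*} [Fintype ι]
    [CommRing A] [CommRing B] [Algebra A B] [Module.Flat A B] [AddCommGroup P] [Module A P]
    [AddCommGroup Q] [Module B Q] (φ : (B ⊗[A] P) ≃ₗ[B] Q) (x : ι → P) (y : ι → Q)
    (h : ∀ i, φ (1 ⊗ₜ x i) = y i) (k : LinearMap.ker (Fintype.linearCombination A x)) (i : ι) :
    (kerLinearCombinationBaseChangeEquiv φ x y h (1 ⊗ₜ k)).1 i = algebraMap A B (k.1 i) := by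
  classical
  change TensorProduct.piScalarRight A B B ι (1 ⊗ₜ k.1) i = _
  simp [Algebra.algebraMap_eq_smul_one]

variable {R A M P ι : Type*} [CommRing R] [CommRing A] [Algebra R A]
  [AddCommGroup M] [Module R M] [AddCommGroup P] [Module A P] [Module R P] [IsScalarTower R A P]

theorem liftBaseChange_surjective_iff_span_range_eq_top (f : M →ₗ[R] P) :
    Function.Surjective (f.liftBaseChange A) ↔ Submodule.span A (Set.range f) = ⊤ := by
  rw [← LinearMap.range_eq_top, LinearMap.range_liftBaseChange, LinearMap.coe_range]

/-- The base-changed map `A ⊗[R] M → P` is injective once the relations over `A` between the images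
of generators of `M` are spanned by the relations over `R` between these generators. -/
theorem liftBaseChange_injective_of_ker_le_span [Fintype ι] (f : M →ₗ[R] P) (m : ι → M)
    (hm : Submodule.span R (Set.range m) = ⊤)
    (hker : LinearMap.ker (Fintype.linearCombination A (f ∘ m)) ≤
      Submodule.span A {v | ∃ w : ι → R, ∑ i, w i • m i = 0 ∧ v = fun i => algebraMap R A (w i)}) :
    Function.Injective (f.liftBaseChange A) := by
  have hsurj : Function.Surjective
      (Fintype.linearCombination A fun i => (1 : A) ⊗ₜ[R] m i) := by
    intro t
    induction t with
    | zero => exact ⟨0, map_zero _⟩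
    | add s t hs ht =>
      obtain ⟨v, rfl⟩ := hs
      obtain ⟨w, rfl⟩ := ht
      exact ⟨v + w, map_add _ _ _⟩
    | tmul a x =>
      obtain ⟨w, rfl⟩ := (span_range_eq_top_iff_surjective_fintypeLinearCombination R m).mp hm x
      refine ⟨fun i => w i • a, ?_⟩
      simp [Fintype.linearCombination_apply, TensorProduct.tmul_sum, TensorProduct.smul_tmul']
  have hzero : Submodule.span A
      {v | ∃ w : ι → R, ∑ i, w i • m i = 0 ∧ v = fun i => algebraMap R A (w i)} ≤
      LinearMap.ker (Fintype.linearCombination A fun i => (1 : A) ⊗ₜ[R] m i) := by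
    rw [Submodule.span_le]
    rintro _ ⟨w, hw, rfl⟩
    have : ∑ i, algebraMap R A (w i) • ((1 : A) ⊗ₜ[R] m i) =
        (1 : A) ⊗ₜ[R] ∑ i, w i • m i := by
      simp [TensorProduct.tmul_sum]
    rw [SetLike.mem_coe, LinearMap.mem_ker, Fintype.linearCombination_apply, this, hw,
      TensorProduct.tmul_zero]
  rw [injective_iff_map_eq_zero]
  intro t ht
  obtain ⟨v, rfl⟩ := hsurj t
  refine hzero (hker ?_)
  simpa [Fintype.linearCombination_apply] using ht

end BaseChange

section Gluing

variable {R R1 R2 R12 : Type u} [CommRing R] [CommRing R1] [CommRing R2] [CommRing R12]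
  [Algebra R R1] [Algebra R R2] [Algebra R R12] [Algebra R1 R12] [Algebra R2 R12]
  [IsScalarTower R R1 R12] [IsScalarTower R R2 R12]

variable (R R1 R2 R12) in
/-- Every finite gluing datum has `M ⊗_R R₁ → M₁` surjective. -/
def GluingSurjective : Prop :=
  ∀ (N1 N2 N12 : Type u)
    (_ : AddCommGroup N1) (_ : Module R1 N1) (_ : Module R N1) (_ : IsScalarTower R R1 N1)
    (_ : AddCommGroup N2) (_ : Module R2 N2) (_ : Module R N2) (_ : IsScalarTower R R2 N2)
    (_ : AddCommGroup N12) (_ : Module R12 N12)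
    (_ : Module.Finite R1 N1) (_ : Module.Finite R2 N2) (_ : Module.Finite R12 N12)
    (ψ1 : (R12 ⊗[R1] N1) ≃ₗ[R12] N12) (ψ2 : (R12 ⊗[R2] N2) ≃ₗ[R12] N12),
    Function.Surjective
      (LinearMap.liftBaseChange R1
        ((LinearMap.fst R N1 N2).comp (glueSubmodule R ψ1 ψ2).subtype))

variable {M1 M2 M12 : Type u}
  [AddCommGroup M1] [Module R1 M1] [Module R M1] [IsScalarTower R R1 M1]
  [AddCommGroup M2] [Module R2 M2] [Module R M2] [IsScalarTower R R2 M2]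
  [AddCommGroup M12] [Module R12 M12]
  (ψ1 : (R12 ⊗[R1] M1) ≃ₗ[R12] M12) (ψ2 : (R12 ⊗[R2] M2) ≃ₗ[R12] M12)

variable (R) in
/-- The projection of the glued module to `M₁`. -/
noncomputable abbrev glueFst : glueSubmodule R ψ1 ψ2 →ₗ[R] M1 :=
  (LinearMap.fst R M1 M2).comp (glueSubmodule R ψ1 ψ2).subtype

variable (R) in
/-- The projection of the glued module to `M₂`. -/
noncomputable abbrev glueSnd : glueSubmodule R ψ1 ψ2 →ₗ[R] M2 :=
  (LinearMap.snd R M1 M2).comp (glueSubmodule R ψ1 ψ2).subtype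

theorem mem_glueSubmodule {x : M1 × M2} :
    x ∈ glueSubmodule R ψ1 ψ2 ↔ ψ1 (1 ⊗ₜ x.1) = ψ2 (1 ⊗ₜ x.2) :=
  Iff.rfl

theorem map_one_tmul_smul {A B P Q : Type*} [CommRing A] [CommRing B] [Algebra A B]
    [AddCommGroup P] [Module A P] [AddCommGroup Q] [Module B Q] (φ : (B ⊗[A] P) ≃ₗ[B] Q)
    (a : A) (x : P) : φ (1 ⊗ₜ (a • x)) = algebraMap A B a • φ (1 ⊗ₜ x) := by
  rw [← map_smul, algebraMap_smul, TensorProduct.tmul_smul]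

theorem exists_sub_eq_of_span_glueFst_eq_top
    (hring : ∀ z : R12, ∃ (x1 : R1) (x2 : R2), algebraMap R1 R12 x1 - algebraMap R2 R12 x2 = z)
    (h : Submodule.span R1 (Set.range (glueFst R ψ1 ψ2)) = ⊤) (z : M12) :
    ∃ (x : M1) (y : M2), y ∈ Submodule.span R2 (Set.range (glueSnd R ψ1 ψ2)) ∧
      ψ1 (1 ⊗ₜ x) - ψ2 (1 ⊗ₜ y) = z := by
  obtain ⟨t, rfl⟩ := ψ1.surjective z
  have exists_add : ∀ {s t : R12 ⊗[R1] M1},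
      (∃ (x : M1) (y : M2), y ∈ Submodule.span R2 (Set.range (glueSnd R ψ1 ψ2)) ∧
        ψ1 (1 ⊗ₜ x) - ψ2 (1 ⊗ₜ y) = ψ1 s) →
      (∃ (x : M1) (y : M2), y ∈ Submodule.span R2 (Set.range (glueSnd R ψ1 ψ2)) ∧
        ψ1 (1 ⊗ₜ x) - ψ2 (1 ⊗ₜ y) = ψ1 t) →
      ∃ (x : M1) (y : M2), y ∈ Submodule.span R2 (Set.range (glueSnd R ψ1 ψ2)) ∧
        ψ1 (1 ⊗ₜ x) - ψ2 (1 ⊗ₜ y) = ψ1 (s + t) := by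
    rintro s t ⟨x, y, hy, hs⟩ ⟨x', y', hy', ht⟩
    refine ⟨x + x', y + y', add_mem hy hy', ?_⟩
    rw [map_add, ← hs, ← ht]
    simp only [TensorProduct.tmul_add, map_add]
    abel
  induction t with
  | zero => exact ⟨0, 0, zero_mem _, by simp⟩
  | add s t hs ht => exact exists_add hs ht
  | tmul c x =>
    have hx : x ∈ Submodule.span R1 (Set.range (glueFst R ψ1 ψ2)) := h ▸ Submodule.mem_top
    induction hx using Submodule.span_induction generalizing c with
    | mem x hx =>
      obtain ⟨s, rfl⟩ := hx
      obtain ⟨a, b, rfl⟩ := hring c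
      refine ⟨a • s.1.1, b • s.1.2,
        Submodule.smul_mem _ _ (Submodule.subset_span ⟨s, rfl⟩), ?_⟩
      rw [map_one_tmul_smul, map_one_tmul_smul, ← (mem_glueSubmodule ψ1 ψ2).mp s.2, ← sub_smul,
        ← map_smul, TensorProduct.smul_tmul', smul_eq_mul, mul_one]
      rfl
    | zero => exact ⟨0, 0, zero_mem _, by simp⟩
    | add x y _ _ hx hy =>
      rw [TensorProduct.tmul_add]
      exact exists_add (hx c) (hy c)
    | smul a x _ hx =>
      rw [← TensorProduct.smul_tmul]
      exact hx (a • c)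

theorem span_glueSnd_eq_top
    (hring : ∀ z : R12, ∃ (x1 : R1) (x2 : R2), algebraMap R1 R12 x1 - algebraMap R2 R12 x2 = z)
    (h : Submodule.span R1 (Set.range (glueFst R ψ1 ψ2)) = ⊤) :
    Submodule.span R2 (Set.range (glueSnd R ψ1 ψ2)) = ⊤ := by
  rw [eq_top_iff]
  intro y₀ _
  obtain ⟨x, y, hy, hxy⟩ := exists_sub_eq_of_span_glueFst_eq_top ψ1 ψ2 hring h (ψ2 (1 ⊗ₜ y₀))
  have hmem : (x, y₀ + y) ∈ glueSubmodule R ψ1 ψ2 := by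
    rw [mem_glueSubmodule, TensorProduct.tmul_add, map_add, ← hxy, sub_add_cancel]
  rw [← add_sub_cancel_right y₀ y]
  exact sub_mem (Submodule.subset_span ⟨⟨_, hmem⟩, rfl⟩) hy

theorem exists_finset_span_image_eq_top {A M P : Type*} [CommRing A] [AddCommGroup P]
    [Module A P] [Module.Finite A P] (f : M → P) (h : Submodule.span A (Set.range f) = ⊤) :
    ∃ s : Finset M, Submodule.span A (f '' s) = ⊤ := by
  classical
  obtain ⟨t, ht, hspan⟩ := (Submodule.fg_span_iff_fg_span_finset_subset (Set.range f)).mp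
    (h ▸ Module.Finite.fg_top)
  rw [← Set.image_univ] at ht
  obtain ⟨s, -, hs⟩ := Finset.subset_set_image_iff.mp ht
  refine ⟨s, ?_⟩
  rw [← Finset.coe_image, hs, ← hspan, h]

/-- A finite family in the glued module generating both `M₁` and `M₂`. -/
theorem exists_finite_family_span_eq_top [Module.Finite R1 M1] [Module.Finite R2 M2]
    (h1 : Submodule.span R1 (Set.range (glueFst R ψ1 ψ2)) = ⊤)
    (h2 : Submodule.span R2 (Set.range (glueSnd R ψ1 ψ2)) = ⊤) :
    ∃ (n : ℕ) (m : Fin n → glueSubmodule R ψ1 ψ2),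
      Submodule.span R1 (Set.range (glueFst R ψ1 ψ2 ∘ m)) = ⊤ ∧
      Submodule.span R2 (Set.range (glueSnd R ψ1 ψ2 ∘ m)) = ⊤ := by
  classical
  obtain ⟨s, hs⟩ := exists_finset_span_image_eq_top _ h1
  obtain ⟨t, ht⟩ := exists_finset_span_image_eq_top _ h2
  have hrange : Set.range (fun i => ((s ∪ t).equivFin.symm i).1) = ↑(s ∪ t) := by
    ext x
    exact ⟨fun ⟨i, hi⟩ => hi ▸ ((s ∪ t).equivFin.symm i).2,
      fun hx => ⟨(s ∪ t).equivFin ⟨x, hx⟩, by simp⟩⟩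
  refine ⟨_, fun i => ((s ∪ t).equivFin.symm i).1, ?_, ?_⟩
  · rw [Set.range_comp, hrange, eq_top_iff, ← hs]
    exact Submodule.span_mono (Set.image_mono (by simp))
  · rw [Set.range_comp, hrange, eq_top_iff, ← ht]
    exact Submodule.span_mono (Set.image_mono (by simp))

theorem linearCombination_algebraMap_fst {n : ℕ} (m : Fin n → glueSubmodule R ψ1 ψ2)
    (w : Fin n → R) :
    Fintype.linearCombination R1 (glueFst R ψ1 ψ2 ∘ m) (fun i => algebraMap R R1 (w i)) =
      (∑ i, w i • m i).1.1 := by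
  change _ = glueFst R ψ1 ψ2 (∑ i, w i • m i)
  simp [Fintype.linearCombination_apply]

theorem linearCombination_algebraMap_snd {n : ℕ} (m : Fin n → glueSubmodule R ψ1 ψ2)
    (w : Fin n → R) :
    Fintype.linearCombination R2 (glueSnd R ψ1 ψ2 ∘ m) (fun i => algebraMap R R2 (w i)) =
      (∑ i, w i • m i).1.2 := by
  change _ = glueSnd R ψ1 ψ2 (∑ i, w i • m i)
  simp [Fintype.linearCombination_apply]

section Relations

variable {n : ℕ} (m : Fin n → glueSubmodule R ψ1 ψ2)

/-- The base change to `R₁₂` of the relations over `R₁` between elements of the glued module. -/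
noncomputable abbrev relationsEquivFst [Module.Flat R1 R12] :
    (R12 ⊗[R1] LinearMap.ker (Fintype.linearCombination R1 (glueFst R ψ1 ψ2 ∘ m))) ≃ₗ[R12]
      LinearMap.ker (Fintype.linearCombination R12 fun i => ψ1 (1 ⊗ₜ (m i).1.1)) :=
  kerLinearCombinationBaseChangeEquiv ψ1 _ _ fun _ => rfl

/-- The base change to `R₁₂` of the relations over `R₂` between elements of the glued module. -/
noncomputable abbrev relationsEquivSnd [Module.Flat R2 R12] :
    (R12 ⊗[R2] LinearMap.ker (Fintype.linearCombination R2 (glueSnd R ψ1 ψ2 ∘ m))) ≃ₗ[R12]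
      LinearMap.ker (Fintype.linearCombination R12 fun i => ψ1 (1 ⊗ₜ (m i).1.1)) :=
  kerLinearCombinationBaseChangeEquiv ψ2 _ _ fun i => (m i).2.symm

theorem coe_relationsEquivFst_one_tmul [Module.Flat R1 R12]
    (k : LinearMap.ker (Fintype.linearCombination R1 (glueFst R ψ1 ψ2 ∘ m))) (i : Fin n) :
    (relationsEquivFst ψ1 ψ2 m (1 ⊗ₜ k)).1 i = algebraMap R1 R12 (k.1 i) :=
  coe_kerLinearCombinationBaseChangeEquiv_one_tmul ψ1 _ _ (fun _ => rfl) k i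

theorem coe_relationsEquivSnd_one_tmul [Module.Flat R2 R12]
    (k : LinearMap.ker (Fintype.linearCombination R2 (glueSnd R ψ1 ψ2 ∘ m))) (i : Fin n) :
    (relationsEquivSnd ψ1 ψ2 m (1 ⊗ₜ k)).1 i = algebraMap R2 R12 (k.1 i) :=
  coe_kerLinearCombinationBaseChangeEquiv_one_tmul ψ2 _ _ (fun i => (m i).2.symm) k i

variable [Module.Flat R1 R12] [Module.Flat R2 R12]

theorem mem_glueSubmodule_relations
    {k : LinearMap.ker (Fintype.linearCombination R1 (glueFst R ψ1 ψ2 ∘ m)) ×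
      LinearMap.ker (Fintype.linearCombination R2 (glueSnd R ψ1 ψ2 ∘ m))} :
    k ∈ glueSubmodule R (relationsEquivFst ψ1 ψ2 m) (relationsEquivSnd ψ1 ψ2 m) ↔
      ∀ i, algebraMap R1 R12 (k.1.1 i) = algebraMap R2 R12 (k.2.1 i) := by
  rw [mem_glueSubmodule, Subtype.ext_iff, funext_iff]
  simp only [coe_relationsEquivFst_one_tmul, coe_relationsEquivSnd_one_tmul]

/-- The relations over `R` between elements of the glued module are glued from the relations over
`R₁` and those over `R₂`. -/
theorem exists_relation_of_glueSubmodule_relations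
    (hmid : ∀ (x1 : R1) (x2 : R2), algebraMap R1 R12 x1 = algebraMap R2 R12 x2 →
      ∃ r : R, algebraMap R R1 r = x1 ∧ algebraMap R R2 r = x2)
    (k : glueSubmodule R (relationsEquivFst ψ1 ψ2 m) (relationsEquivSnd ψ1 ψ2 m)) :
    ∃ w : Fin n → R, ∑ i, w i • m i = 0 ∧ k.1.1.1 = (fun i => algebraMap R R1 (w i)) ∧
      k.1.2.1 = fun i => algebraMap R R2 (w i) := by
  choose w hw1 hw2 using fun i => hmid _ _ ((mem_glueSubmodule_relations ψ1 ψ2 m).mp k.2 i)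
  have e1 := funext hw1
  have e2 := funext hw2
  refine ⟨w, Subtype.ext (Prod.ext ?_ ?_), e1.symm, e2.symm⟩
  · rw [← linearCombination_algebraMap_fst, e1]
    exact k.1.1.2
  · rw [← linearCombination_algebraMap_snd, e2]
    exact k.1.2.2

theorem span_range_eq_top_of_span_relations_eq_top
    (hmid : ∀ (x1 : R1) (x2 : R2), algebraMap R1 R12 x1 = algebraMap R2 R12 x2 →
      ∃ r : R, algebraMap R R1 r = x1 ∧ algebraMap R R2 r = x2)
    (hring : ∀ z : R12, ∃ (x1 : R1) (x2 : R2), algebraMap R1 R12 x1 - algebraMap R2 R12 x2 = z)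
    (h1 : Submodule.span R1 (Set.range (glueFst R ψ1 ψ2 ∘ m)) = ⊤)
    (h2 : Submodule.span R2 (Set.range (glueSnd R ψ1 ψ2 ∘ m)) = ⊤)
    (hrel : Submodule.span R1 (Set.range
      (glueFst R (relationsEquivFst ψ1 ψ2 m) (relationsEquivSnd ψ1 ψ2 m))) = ⊤) :
    Submodule.span R (Set.range m) = ⊤ := by
  rw [span_range_eq_top_iff_surjective_fintypeLinearCombination] at h1 h2 ⊢
  intro x
  obtain ⟨v1, hv1⟩ := h1 x.1.1
  obtain ⟨v2, hv2⟩ := h2 x.1.2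
  have hz : (fun i => algebraMap R1 R12 (v1 i) - algebraMap R2 R12 (v2 i)) ∈
      LinearMap.ker (Fintype.linearCombination R12 fun i => ψ1 (1 ⊗ₜ (m i).1.1)) := by
    have e1 : ∑ i, algebraMap R1 R12 (v1 i) • ψ1 (1 ⊗ₜ (m i).1.1) = ψ1 (1 ⊗ₜ x.1.1) := by
      rw [← hv1, Fintype.linearCombination_apply, TensorProduct.tmul_sum, map_sum]
      exact Finset.sum_congr rfl fun i _ => (map_one_tmul_smul ψ1 _ _).symm
    have e2 : ∑ i, algebraMap R2 R12 (v2 i) • ψ1 (1 ⊗ₜ (m i).1.1) = ψ2 (1 ⊗ₜ x.1.2) := by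
      rw [← hv2, Fintype.linearCombination_apply, TensorProduct.tmul_sum, map_sum]
      refine Finset.sum_congr rfl fun i _ => ?_
      rw [map_one_tmul_smul ψ2, (mem_glueSubmodule ψ1 ψ2).mp (m i).2]
      rfl
    rw [LinearMap.mem_ker, Fintype.linearCombination_apply]
    simp only [sub_smul, Finset.sum_sub_distrib]
    rw [e1, e2, sub_eq_zero]
    exact x.2
  obtain ⟨k1, k2, -, hk⟩ := exists_sub_eq_of_span_glueFst_eq_top _ _ hring hrel ⟨_, hz⟩
  have hk' (i : Fin n) : algebraMap R1 R12 (k1.1 i) - algebraMap R2 R12 (k2.1 i) =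
      algebraMap R1 R12 (v1 i) - algebraMap R2 R12 (v2 i) := by
    have := congrFun (congrArg Subtype.val hk) i
    rwa [Submodule.coe_sub, Pi.sub_apply, coe_relationsEquivFst_one_tmul,
      coe_relationsEquivSnd_one_tmul] at this
  choose w hw1 hw2 using fun i => hmid (v1 i - k1.1 i) (v2 i - k2.1 i) (by
    rw [map_sub, map_sub]
    linear_combination -hk' i)
  refine ⟨w, Subtype.ext (Prod.ext ?_ ?_)⟩
  · rw [Fintype.linearCombination_apply, ← linearCombination_algebraMap_fst, funext hw1]
    exact (map_sub _ v1 k1.1).trans (by rw [k1.2, sub_zero, hv1])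
  · rw [Fintype.linearCombination_apply, ← linearCombination_algebraMap_snd, funext hw2]
    exact (map_sub _ v2 k2.1).trans (by rw [k2.2, sub_zero, hv2])

end Relations

theorem GluingSurjective.span_glueFst_eq_top (H : GluingSurjective R R1 R2 R12)
    [Module.Finite R1 M1] [Module.Finite R2 M2] :
    Submodule.span R1 (Set.range (glueFst R ψ1 ψ2)) = ⊤ :=
  have : Module.Finite R12 M12 := Module.Finite.equiv ψ1
  (liftBaseChange_surjective_iff_span_range_eq_top _).mp
    (H M1 M2 M12 _ _ _ inferInstance _ _ _ inferInstance _ _ inferInstance inferInstance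
      inferInstance ψ1 ψ2)

/-- A finite family generating the glued module over `R` and both `M₁` and `M₂`. -/
theorem GluingSurjective.exists_generators [IsNoetherianRing R1] [IsNoetherianRing R2]
    [Module.Flat R1 R12] [Module.Flat R2 R12] (H : GluingSurjective R R1 R2 R12)
    (hmid : ∀ (x1 : R1) (x2 : R2), algebraMap R1 R12 x1 = algebraMap R2 R12 x2 →
      ∃ r : R, algebraMap R R1 r = x1 ∧ algebraMap R R2 r = x2)
    (hring : ∀ z : R12, ∃ (x1 : R1) (x2 : R2), algebraMap R1 R12 x1 - algebraMap R2 R12 x2 = z)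
    [Module.Finite R1 M1] [Module.Finite R2 M2] :
    ∃ (n : ℕ) (m : Fin n → glueSubmodule R ψ1 ψ2), Submodule.span R (Set.range m) = ⊤ := by
  have hfst := H.span_glueFst_eq_top ψ1 ψ2
  obtain ⟨n, m, h1, h2⟩ := exists_finite_family_span_eq_top ψ1 ψ2 hfst
    (span_glueSnd_eq_top ψ1 ψ2 hring hfst)
  exact ⟨n, m, span_range_eq_top_of_span_relations_eq_top ψ1 ψ2 m hmid hring h1 h2
    (H.span_glueFst_eq_top _ _)⟩

theorem GluingSurjective.finite_glueSubmodule [IsNoetherianRing R1] [IsNoetherianRing R2]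
    [Module.Flat R1 R12] [Module.Flat R2 R12] (H : GluingSurjective R R1 R2 R12)
    (hmid : ∀ (x1 : R1) (x2 : R2), algebraMap R1 R12 x1 = algebraMap R2 R12 x2 →
      ∃ r : R, algebraMap R R1 r = x1 ∧ algebraMap R R2 r = x2)
    (hring : ∀ z : R12, ∃ (x1 : R1) (x2 : R2), algebraMap R1 R12 x1 - algebraMap R2 R12 x2 = z)
    [Module.Finite R1 M1] [Module.Finite R2 M2] :
    Module.Finite R (glueSubmodule R ψ1 ψ2) := by
  obtain ⟨n, m, hm⟩ := H.exists_generators ψ1 ψ2 hmid hring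
  exact ⟨hm ▸ Submodule.fg_span (Set.finite_range m)⟩

theorem fg_ker_linearCombination [Module.Flat R1 R12] [Module.Flat R2 R12] {n : ℕ}
    (m : Fin n → glueSubmodule R ψ1 ψ2)
    (hinj : Function.Injective fun r : R => (algebraMap R R1 r, algebraMap R R2 r))
    (hmid : ∀ (x1 : R1) (x2 : R2), algebraMap R1 R12 x1 = algebraMap R2 R12 x2 →
      ∃ r : R, algebraMap R R1 r = x1 ∧ algebraMap R R2 r = x2)
    [Module.Finite R (glueSubmodule R (relationsEquivFst ψ1 ψ2 m) (relationsEquivSnd ψ1 ψ2 m))] :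
    (LinearMap.ker (Fintype.linearCombination R m)).FG := by
  have hsum (w : LinearMap.ker (Fintype.linearCombination R m)) : ∑ i, w.1 i • m i = 0 := w.2
  let f : LinearMap.ker (Fintype.linearCombination R m) →ₗ[R]
      glueSubmodule R (relationsEquivFst ψ1 ψ2 m) (relationsEquivSnd ψ1 ψ2 m) :=
    { toFun := fun w => ⟨(⟨fun i => algebraMap R R1 (w.1 i), by
          rw [LinearMap.mem_ker, linearCombination_algebraMap_fst, hsum]; rfl⟩,
        ⟨fun i => algebraMap R R2 (w.1 i), by
          rw [LinearMap.mem_ker, linearCombination_algebraMap_snd, hsum]; rfl⟩), by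
          rw [mem_glueSubmodule_relations]
          intro i
          rw [← IsScalarTower.algebraMap_apply, ← IsScalarTower.algebraMap_apply]⟩
      map_add' := fun v w => Subtype.ext (Prod.ext
        (Subtype.ext (funext fun _ => map_add _ _ _)) (Subtype.ext (funext fun _ => map_add _ _ _)))
      map_smul' := fun r w => Subtype.ext (Prod.ext
        (Subtype.ext (funext fun _ => (Algebra.linearMap R R1).map_smul r _))
        (Subtype.ext (funext fun _ => (Algebra.linearMap R R2).map_smul r _))) }
  have hf : Function.Bijective f := by
    refine ⟨fun v w hvw => ?_, fun k => ?_⟩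
    · ext i
      refine hinj (Prod.ext ?_ ?_)
      · exact congrArg (fun k => k.1.1.1 i) hvw
      · exact congrArg (fun k => k.1.2.1 i) hvw
    · obtain ⟨w, hw, hw1, hw2⟩ := exists_relation_of_glueSubmodule_relations ψ1 ψ2 m hmid k
      exact ⟨⟨w, hw⟩, Subtype.ext (Prod.ext (Subtype.ext hw1.symm) (Subtype.ext hw2.symm))⟩
  exact Module.Finite.iff_fg.mp (Module.Finite.equiv (LinearEquiv.ofBijective f hf).symm)

end Gluing

/-- Kedlaya–Liu / Ding–Liu–Liu–Zhu gluing.  Let `R → R₁, R₂ → R₁₂` be a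
gluing diagram with `R₁, R₂` noetherian and `R₁ → R₁₂`, `R₂ → R₁₂` flat.  Suppose that for
every finite gluing datum the natural map `M ⊗_R R₁ → M₁` is surjective.  Then for every
finite gluing datum the glued module `M = ker(ψ₁ - ψ₂)` is a finitely presented `R`-module
and the natural base-change maps `M ⊗_R R₁ → M₁` and `M ⊗_R R₂ → M₂` are bijective. -/
theorem gluing_datum_finitePresentation_bijective
    {R R1 R2 R12 : Type u} [CommRing R] [CommRing R1] [CommRing R2] [CommRing R12]
    [Algebra R R1] [Algebra R R2] [Algebra R R12] [Algebra R1 R12] [Algebra R2 R12]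
    [IsScalarTower R R1 R12] [IsScalarTower R R2 R12]
    [IsNoetherianRing R1] [IsNoetherianRing R2]
    [Module.Flat R1 R12] [Module.Flat R2 R12]
    (hinj : Function.Injective fun r : R => (algebraMap R R1 r, algebraMap R R2 r))
    (hmid : ∀ (x1 : R1) (x2 : R2), algebraMap R1 R12 x1 = algebraMap R2 R12 x2 →
      ∃ r : R, algebraMap R R1 r = x1 ∧ algebraMap R R2 r = x2)
    (hsurjring : ∀ z : R12, ∃ (x1 : R1) (x2 : R2),
      algebraMap R1 R12 x1 - algebraMap R2 R12 x2 = z)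
    (hsurj_all : ∀ (N1 N2 N12 : Type u)
      (_ : AddCommGroup N1) (_ : Module R1 N1) (_ : Module R N1) (_ : IsScalarTower R R1 N1)
      (_ : AddCommGroup N2) (_ : Module R2 N2) (_ : Module R N2) (_ : IsScalarTower R R2 N2)
      (_ : AddCommGroup N12) (_ : Module R12 N12)
      (_ : Module.Finite R1 N1) (_ : Module.Finite R2 N2) (_ : Module.Finite R12 N12)
      (ψ1 : (R12 ⊗[R1] N1) ≃ₗ[R12] N12) (ψ2 : (R12 ⊗[R2] N2) ≃ₗ[R12] N12),
      Function.Surjective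
        (LinearMap.liftBaseChange R1
          ((LinearMap.fst R N1 N2).comp (glueSubmodule R ψ1 ψ2).subtype)))
    {M1 M2 M12 : Type u}
    [AddCommGroup M1] [Module R1 M1] [Module R M1] [IsScalarTower R R1 M1]
    [AddCommGroup M2] [Module R2 M2] [Module R M2] [IsScalarTower R R2 M2]
    [AddCommGroup M12] [Module R12 M12]
    [Module.Finite R1 M1] [Module.Finite R2 M2] [Module.Finite R12 M12]
    (ψ1 : (R12 ⊗[R1] M1) ≃ₗ[R12] M12) (ψ2 : (R12 ⊗[R2] M2) ≃ₗ[R12] M12) :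
    Module.FinitePresentation R (glueSubmodule R ψ1 ψ2) ∧
    Function.Bijective
      (LinearMap.liftBaseChange R1
        ((LinearMap.fst R M1 M2).comp (glueSubmodule R ψ1 ψ2).subtype)) ∧
    Function.Bijective
      (LinearMap.liftBaseChange R2
        ((LinearMap.snd R M1 M2).comp (glueSubmodule R ψ1 ψ2).subtype)) := by
  have H : GluingSurjective R R1 R2 R12 := hsurj_all
  have hfst := H.span_glueFst_eq_top ψ1 ψ2
  obtain ⟨n, m, hm⟩ := H.exists_generators ψ1 ψ2 hmid hsurjring
  have hrel1 := H.span_glueFst_eq_top (relationsEquivFst ψ1 ψ2 m) (relationsEquivSnd ψ1 ψ2 m)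
  have hrel2 := span_glueSnd_eq_top _ _ hsurjring hrel1
  have hfin := H.finite_glueSubmodule (relationsEquivFst ψ1 ψ2 m) (relationsEquivSnd ψ1 ψ2 m)
    hmid hsurjring
  refine ⟨Module.finitePresentation_of_surjective (Fintype.linearCombination R m)
    ((span_range_eq_top_iff_surjective_fintypeLinearCombination R m).mp hm)
    (fg_ker_linearCombination ψ1 ψ2 m hinj hmid), ⟨?_, ?_⟩, ⟨?_, ?_⟩⟩
  · refine liftBaseChange_injective_of_ker_le_span _ m hm ?_
    rw [← Submodule.map_subtype_top (LinearMap.ker _), ← hrel1, Submodule.map_span]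
    refine Submodule.span_mono ?_
    rintro _ ⟨_, ⟨k, rfl⟩, rfl⟩
    obtain ⟨w, hw, hw1, -⟩ := exists_relation_of_glueSubmodule_relations ψ1 ψ2 m hmid k
    exact ⟨w, hw, hw1⟩
  · exact (liftBaseChange_surjective_iff_span_range_eq_top _).mpr hfst
  · refine liftBaseChange_injective_of_ker_le_span _ m hm ?_
    rw [← Submodule.map_subtype_top (LinearMap.ker _), ← hrel2, Submodule.map_span]
    refine Submodule.span_mono ?_
    rintro _ ⟨_, ⟨k, rfl⟩, rfl⟩
    obtain ⟨w, hw, -, hw2⟩ := exists_relation_of_glueSubmodule_relations ψ1 ψ2 m hmid k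
    exact ⟨w, hw, hw2⟩
  · exact (liftBaseChange_surjective_iff_span_range_eq_top _).mpr
      (span_glueSnd_eq_top ψ1 ψ2 hsurjring hfst)
end

section
/- Let B be a Q_p-Banach algebra with continuous action of a finite group G such that B is finite free and faithfully flat over B^G, and B ⊗_{B^G} B ≅ ⊕_{g∈G} B·e_g with orthogonal idempotents e_g satisfying g(e_h) = e_{gh}. Then for any Banach algebra S with trivial G-action and any locally free finite-type S⊗̂B-module M with semilinear G-action: (1) M^G is a locally free finite-type S⊗̂B^G-module, and (2) the natural map (S⊗̂B) ⊗_{S⊗̂B^G} M^G → M is an isomorphism. -/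
open TensorProduct

set_option maxHeartbeats 1000000
set_option synthInstance.maxHeartbeats 400000

universe u

theorem sum_smul_sum_of_galois_coordinates {C G P I : Type*} [CommRing C] [Group G] [Fintype G]
    [AddCommGroup P] [Module C P] (T : G → C →+* C) (s : Finset I) (x y : I → C)
    (hone : ∑ i ∈ s, x i * T 1 (y i) = 1)
    (hne : ∀ g : G, g ≠ 1 → ∑ i ∈ s, x i * T g (y i) = 0) (f : G → P) :
    ∑ i ∈ s, x i • ∑ g, T g (y i) • f g = f 1 := by
  simp_rw [Finset.smul_sum, smul_smul]
  rw [Finset.sum_comm]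
  simp_rw [← Finset.sum_smul]
  rw [Finset.sum_eq_single 1 (fun g _ hg => by rw [hne g hg, zero_smul]) (by simp),
    hone, one_smul]

/-- Elements `x i`, `y i` with `∑ x i * g (y i) = δ_{g,1}` make the natural map
`C ⊗[D] M^G → M` bijective for every `C`-module `M` with semilinear `G`-action. -/
theorem bijective_liftBaseChange_of_galois_coordinates
    {D C G M I : Type*} [CommRing D] [CommRing C] [Algebra D C] [Group G] [Fintype G]
    [AddCommGroup M] [Module C M] [Module D M] [IsScalarTower D C M] [DistribMulAction G M]
    (T : G → C →+* C) (hT : ∀ c, T 1 c = c)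
    (htrace : ∀ c, ∃ d : D, algebraMap D C d = ∑ g, T g c)
    (hsemi : ∀ (g : G) (c : C) (m : M), g • (c • m) = T g c • (g • m))
    (N : Submodule D M) (hN : ∀ m, m ∈ N ↔ ∀ g : G, g • m = m)
    (s : Finset I) (x y : I → C)
    (hone : ∑ i ∈ s, x i * T 1 (y i) = 1)
    (hne : ∀ g : G, g ≠ 1 → ∑ i ∈ s, x i * T g (y i) = 0) :
    Function.Bijective (LinearMap.liftBaseChange C N.subtype) := by
  have hmem : ∀ m : M, ∑ g : G, g • m ∈ N := by
    intro m
    rw [hN]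
    intro h
    rw [Finset.smul_sum]
    simp_rw [smul_smul]
    exact Fintype.sum_bijective (h * ·) (Group.mulLeft_bijective h) _ _ (fun _ => rfl)
  let t : M →+ N :=
    { toFun := fun m => ⟨∑ g : G, g • m, hmem m⟩
      map_zero' := by ext; simp
      map_add' := fun a b => by ext; simp [Finset.sum_add_distrib] }
  have ht : ∀ m, (t m : M) = ∑ g : G, g • m := fun _ => rfl
  have hleft : ∀ z : C ⊗[D] N,
      ∑ i ∈ s, x i ⊗ₜ[D] t (y i • LinearMap.liftBaseChange C N.subtype z) = z := by
    intro z
    induction z using TensorProduct.induction_on with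
    | zero => simp
    | add a b ha hb =>
      simp only [map_add, smul_add, TensorProduct.tmul_add, Finset.sum_add_distrib, ha, hb]
    | tmul c n =>
      choose d hd using htrace
      have hn : ∀ i, t (y i • LinearMap.liftBaseChange C N.subtype (c ⊗ₜ[D] n)) =
          d (y i * c) • n := by
        intro i
        ext
        rw [ht, LinearMap.liftBaseChange_tmul, Submodule.subtype_apply, Submodule.coe_smul,
          ← algebraMap_smul C (d (y i * c)) (n : M), hd, Finset.sum_smul]
        refine Finset.sum_congr rfl fun g _ => ?_
        rw [smul_smul, hsemi, (hN n).1 n.2 g]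
      simp_rw [hn, ← TensorProduct.smul_tmul]
      rw [← TensorProduct.sum_tmul]
      congr 1
      refine Eq.trans ?_ ((sum_smul_sum_of_galois_coordinates T s x y hone hne
        fun g => T g c).trans (hT c))
      refine Finset.sum_congr rfl fun i _ => ?_
      rw [Algebra.smul_def, hd, mul_comm]
      simp
  refine ⟨fun a b hab => ?_, fun m => ⟨∑ i ∈ s, x i ⊗ₜ[D] t (y i • m), ?_⟩⟩
  · rw [← hleft a, ← hleft b, hab]
  · simp only [map_sum, LinearMap.liftBaseChange_tmul, Submodule.subtype_apply, ht, hsemi]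
    rw [sum_smul_sum_of_galois_coordinates T s x y hone hne fun g => g • m, one_smul]

theorem projective_trans (D C M : Type*) [CommRing D] [CommRing C] [Algebra D C]
    [Module.Projective D C] [AddCommGroup M] [Module C M] [Module D M] [IsScalarTower D C M]
    [Module.Projective C M] : Module.Projective D M := by
  classical
  obtain ⟨r, hr⟩ := Module.projective_def'.1 ‹Module.Projective C M›
  have : Module.Projective D (M →₀ C) :=
    .of_equiv' (finsuppLequivDFinsupp (ι := M) (M := C) D).symm
  refine .of_split (r.restrictScalars D)
    ((Finsupp.linearCombination C (id : M → M)).restrictScalars D) ?_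
  ext m
  exact LinearMap.congr_fun hr m

/-- Finite projectivity descends along a finite projective extension `D → C` admitting a
surjective functional `C → D`. -/
theorem finite_projective_of_bijective_liftBaseChange
    {D C M : Type*} [CommRing D] [CommRing C] [Algebra D C] [Module.Finite D C]
    [Module.Projective D C] [AddCommGroup M] [Module C M] [Module D M] [IsScalarTower D C M]
    [Module.Finite C M] [Module.Projective C M] (N : Submodule D M)
    (hN : Function.Bijective (LinearMap.liftBaseChange C N.subtype))
    (f : C →ₗ[D] D) (c : C) (hf : f c = 1) :
    Module.Finite D N ∧ Module.Projective D N := by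
  have : Module.Finite D M := Module.Finite.trans C M
  have : Module.Projective D M := projective_trans D C M
  let E : (C ⊗[D] N) ≃ₗ[D] M := (LinearEquiv.ofBijective _ hN).restrictScalars D
  let p : M →ₗ[D] N := (TensorProduct.lid D N).toLinearMap ∘ₗ f.rTensor N ∘ₗ E.symm.toLinearMap
  let q : N →ₗ[D] M := E.toLinearMap ∘ₗ TensorProduct.mk D C N c
  have hpq : p ∘ₗ q = LinearMap.id := by
    ext n
    simp [p, q, hf]
  exact ⟨Module.Finite.of_surjective p fun n => ⟨q n, LinearMap.congr_fun hpq n⟩,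
    Module.Projective.of_split q p hpq⟩

/-- A free algebra has a surjective functional once the base embeds in it. -/
theorem exists_linearMap_apply_eq_one {A B : Type*} [CommRing A] [CommRing B] [Algebra A B]
    [Module.Free A B] (hinj : Function.Injective (algebraMap A B)) :
    ∃ (f : B →ₗ[A] A) (b : B), f b = 1 := by
  cases subsingleton_or_nontrivial B
  · have := hinj.subsingleton
    exact ⟨0, 0, Subsingleton.elim _ _⟩
  · let b := Module.Free.chooseBasis A B
    obtain ⟨i⟩ := b.index_nonempty
    exact ⟨b.coord i, b i, by simp⟩

/-- If the translates of `e 1` form a `B`-basis of `B ⊗[A] B`, then there are elements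
`x i`, `y i` of `B` with `∑ x i * g (y i) = δ_{g,1}`. -/
theorem exists_galois_coordinates {R B G : Type*} [CommRing R] [CommRing B] [Algebra R B]
    [Group G] [Fintype G] [MulSemiringAction G B]
    (T : G → (B ⊗[R] B) →+* (B ⊗[R] B))
    (hT : ∀ (g : G) (x y : B), T g (x ⊗ₜ[R] y) = (g • x) ⊗ₜ[R] y)
    (e : G → B ⊗[R] B)
    (hbasis : ∀ x : B ⊗[R] B, ∃! cf : G → B, x = ∑ g, (cf g ⊗ₜ[R] (1 : B)) * e g)
    (hTe : ∀ g h : G, T g (e h) = e (g * h)) :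
    ∃ (s : Finset (B × B)) (x y : B × B → B), ∑ i ∈ s, x i * y i = 1 ∧
      ∀ g : G, g ≠ 1 → ∑ i ∈ s, x i * g • y i = 0 := by
  classical
  choose cf hcf huniq using fun y : B => hbasis (1 ⊗ₜ[R] y)
  have hequiv : ∀ (y : B) (g : G), cf y g = g • cf y 1 := by
    intro y g
    have h : (fun h => g • cf y (g⁻¹ * h)) = cf y := by
      refine huniq y _ ?_
      have h1 := congrArg (T g) (hcf y)
      simp only [hT, smul_one, map_sum, map_mul, hTe] at h1
      rw [h1]
      exact Fintype.sum_bijective (g * ·) (Group.mulLeft_bijective g) _ _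
        (fun h => by simp)
    have := congrFun h g
    simpa using this.symm
  obtain ⟨s, hs⟩ := TensorProduct.exists_finset (e 1)
  have h : (fun g => ∑ i ∈ s, i.1 * cf i.2 g) = Pi.single 1 1 := by
    refine (hbasis (e 1)).unique ?_ ?_
    · simp_rw [TensorProduct.sum_tmul, Finset.sum_mul]
      rw [Finset.sum_comm]
      conv_lhs => rw [hs]
      refine Finset.sum_congr rfl fun i _ => ?_
      have h2 : i.1 ⊗ₜ[R] i.2 = (i.1 ⊗ₜ[R] (1 : B)) * ((1 : B) ⊗ₜ[R] i.2) := by simp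
      rw [h2, hcf i.2, Finset.mul_sum]
      refine Finset.sum_congr rfl fun g _ => ?_
      rw [← mul_assoc, Algebra.TensorProduct.tmul_mul_tmul, one_mul]
    · rw [Finset.sum_eq_single 1 (fun g _ hg => by simp [Pi.single_eq_of_ne hg]) (by simp)]
      simp [← Algebra.TensorProduct.one_def]
  refine ⟨s, Prod.fst, fun i => cf i.2 1, ?_, fun g hg => ?_⟩
  · simpa using congrFun h 1
  · have := congrFun h g
    simp only [Pi.single_eq_of_ne hg] at this
    simpa only [← hequiv] using this

/-- The base change `S ⊗ f` of an `A`-linear map `f : B → A`, as a linear map over `S ⊗ A`. -/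
noncomputable def lTensorSubalgebraFunctional (S : Type*) {B : Type*} [CommRing S] [CommRing B]
    (A : Subalgebra ℤ B) [Algebra (S ⊗[ℤ] A) (S ⊗[ℤ] B)]
    (halg : ∀ d, algebraMap (S ⊗[ℤ] A) (S ⊗[ℤ] B) d =
      Algebra.TensorProduct.map (AlgHom.id ℤ S) A.val d)
    (f : B →ₗ[A] A) : (S ⊗[ℤ] B) →ₗ[S ⊗[ℤ] A] (S ⊗[ℤ] A) where
  toFun := (f.toAddMonoidHom.toIntLinearMap).lTensor S
  map_add' := map_add _
  map_smul' d c := by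
    rw [Algebra.smul_def, halg, RingHom.id_apply, smul_eq_mul]
    induction d using TensorProduct.induction_on with
    | zero => simp
    | add a b ha hb => simp only [map_add, add_mul, ha, hb]
    | tmul s a =>
      induction c using TensorProduct.induction_on with
      | zero => simp
      | add a b ha hb => simp only [map_add, mul_add, ha, hb]
      | tmul r b =>
        have : f ((a : B) * b) = a * f b := by
          rw [← smul_eq_mul a (f b), ← map_smul]
          rfl
        simp [this]

theorem lTensorSubalgebraFunctional_one_tmul (S : Type*) {B : Type*} [CommRing S] [CommRing B]
    (A : Subalgebra ℤ B) [Algebra (S ⊗[ℤ] A) (S ⊗[ℤ] B)]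
    (halg : ∀ d, algebraMap (S ⊗[ℤ] A) (S ⊗[ℤ] B) d =
      Algebra.TensorProduct.map (AlgHom.id ℤ S) A.val d)
    (f : B →ₗ[A] A) (b : B) (hfb : f b = 1) :
    lTensorSubalgebraFunctional S A halg f (1 ⊗ₜ b) = 1 := by
  simp [lTensorSubalgebraFunctional, hfb, Algebra.TensorProduct.one_def]

theorem finite_projective_tensorProduct_subalgebra {S B : Type*} [CommRing S] [CommRing B]
    (A : Subalgebra ℤ B) [Module.Finite A B] [Module.Free A B]
    [Algebra (S ⊗[ℤ] A) (S ⊗[ℤ] B)]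
    (halg : ∀ d, algebraMap (S ⊗[ℤ] A) (S ⊗[ℤ] B) d =
      Algebra.TensorProduct.map (AlgHom.id ℤ S) A.val d) :
    Module.Finite (S ⊗[ℤ] A) (S ⊗[ℤ] B) ∧ Module.Projective (S ⊗[ℤ] A) (S ⊗[ℤ] B) := by
  let b := Module.Free.chooseBasis A B
  let p : (S ⊗[ℤ] B) →ₗ[S ⊗[ℤ] A] (Module.Free.ChooseBasisIndex A B → S ⊗[ℤ] A) :=
    LinearMap.pi fun i => lTensorSubalgebraFunctional S A halg (b.coord i)
  let q := Fintype.linearCombination (S ⊗[ℤ] A) fun i => (1 : S) ⊗ₜ[ℤ] b i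
  have hqp : q ∘ₗ p = LinearMap.id := by
    refine LinearMap.ext fun c => ?_
    induction c using TensorProduct.induction_on with
    | zero => simp
    | add a b ha hb => rw [map_add, ha, hb, map_add]
    | tmul s x =>
      have hx : ∑ i, (b.repr x i : B) * b i = x := b.sum_repr x
      simp only [LinearMap.comp_apply, q, p, Fintype.linearCombination_apply, LinearMap.pi_apply,
        LinearMap.id_apply, Algebra.smul_def, halg]
      conv_rhs => rw [← hx, TensorProduct.tmul_sum]
      refine Finset.sum_congr rfl fun i _ => ?_
      simp [lTensorSubalgebraFunctional]
  exact ⟨Module.Finite.of_surjective q fun c => ⟨p c, LinearMap.congr_fun hqp c⟩,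
    Module.Projective.of_split p q hqp⟩

theorem tensorProduct_action_one {S B G : Type*} [CommRing S] [CommRing B] [Group G]
    [MulSemiringAction G B] (TC : G → ((S ⊗[ℤ] B) →+* (S ⊗[ℤ] B)))
    (hTC : ∀ (g : G) (s : S) (b : B), TC g (s ⊗ₜ[ℤ] b) = s ⊗ₜ[ℤ] (g • b)) (c : S ⊗[ℤ] B) :
    TC 1 c = c := by
  induction c using TensorProduct.induction_on with
  | zero => simp
  | add a b ha hb => rw [map_add, ha, hb]
  | tmul s b => rw [hTC, one_smul]

/-- Traces of elements of `S ⊗ B` come from `S ⊗ B^G`. -/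
theorem exists_algebraMap_eq_sum_tensorProduct_action {S B G : Type*} [CommRing S] [CommRing B]
    [Group G] [Fintype G] [MulSemiringAction G B]
    (A : Subalgebra ℤ B) (hA : ∀ x : B, x ∈ A ↔ ∀ g : G, g • x = x)
    (TC : G → ((S ⊗[ℤ] B) →+* (S ⊗[ℤ] B)))
    (hTC : ∀ (g : G) (s : S) (b : B), TC g (s ⊗ₜ[ℤ] b) = s ⊗ₜ[ℤ] (g • b))
    [Algebra (S ⊗[ℤ] A) (S ⊗[ℤ] B)]
    (halg : ∀ d, algebraMap (S ⊗[ℤ] A) (S ⊗[ℤ] B) d =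
      Algebra.TensorProduct.map (AlgHom.id ℤ S) A.val d) (c : S ⊗[ℤ] B) :
    ∃ d, algebraMap (S ⊗[ℤ] A) (S ⊗[ℤ] B) d = ∑ g, TC g c := by
  induction c using TensorProduct.induction_on with
  | zero => exact ⟨0, by simp⟩
  | add a b ha hb =>
    obtain ⟨a', ha⟩ := ha
    obtain ⟨b', hb⟩ := hb
    exact ⟨a' + b', by simp only [map_add, ha, hb, Finset.sum_add_distrib]⟩
  | tmul s b =>
    have hmem : ∑ g : G, g • b ∈ A := by
      rw [hA]
      intro h
      rw [Finset.smul_sum]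
      simp_rw [smul_smul]
      exact Fintype.sum_bijective (h * ·) (Group.mulLeft_bijective h) _ _ (fun _ => rfl)
    refine ⟨s ⊗ₜ ⟨_, hmem⟩, ?_⟩
    simp [halg, hTC, TensorProduct.tmul_sum]

/-- Galois descent for `S ⊗ B` over `S ⊗ A`, for any `S ⊗ A`-algebra structure on `S ⊗ B` that
agrees with the canonical one. -/
theorem galois_descent_of_algebraMap_eq {S B G M : Type*} [CommRing S] [CommRing B]
    [Group G] [Fintype G] [MulSemiringAction G B]
    (A : Subalgebra ℤ B) (hA : ∀ x : B, x ∈ A ↔ ∀ g : G, g • x = x)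
    [Module.Finite A B] [Module.Free A B]
    (TB : G → ((B ⊗[A] B) →+* (B ⊗[A] B)))
    (hTB : ∀ (g : G) (x y : B), TB g (x ⊗ₜ[A] y) = (g • x) ⊗ₜ[A] y)
    (e : G → (B ⊗[A] B))
    (hbasis : ∀ x : B ⊗[A] B, ∃! cf : G → B, x = ∑ g : G, (cf g ⊗ₜ[A] (1 : B)) * e g)
    (hGe : ∀ g h : G, TB g (e h) = e (g * h))
    (TC : G → ((S ⊗[ℤ] B) →+* (S ⊗[ℤ] B)))
    (hTC : ∀ (g : G) (s : S) (b : B), TC g (s ⊗ₜ[ℤ] b) = s ⊗ₜ[ℤ] (g • b))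
    [AddCommGroup M] [Module (S ⊗[ℤ] B) M]
    [Module.Finite (S ⊗[ℤ] B) M] [Module.Projective (S ⊗[ℤ] B) M] [DistribMulAction G M]
    (hsemi : ∀ (g : G) (x : S ⊗[ℤ] B) (m : M), g • (x • m) = TC g x • (g • m))
    [Algebra (S ⊗[ℤ] A) (S ⊗[ℤ] B)] [Module (S ⊗[ℤ] A) M]
    [IsScalarTower (S ⊗[ℤ] A) (S ⊗[ℤ] B) M]
    (halg : ∀ d, algebraMap (S ⊗[ℤ] A) (S ⊗[ℤ] B) d =
      Algebra.TensorProduct.map (AlgHom.id ℤ S) A.val d)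
    (N : Submodule (S ⊗[ℤ] A) M) (hN : ∀ m, m ∈ N ↔ ∀ g : G, g • m = m) :
    Module.Finite (S ⊗[ℤ] A) N ∧ Module.Projective (S ⊗[ℤ] A) N ∧
      Function.Bijective (LinearMap.liftBaseChange (S ⊗[ℤ] B) N.subtype) := by
  have hbij : Function.Bijective (LinearMap.liftBaseChange (S ⊗[ℤ] B) N.subtype) := by
    obtain ⟨s, x, y, hone, hne⟩ := exists_galois_coordinates TB hTB e hbasis hGe
    refine bijective_liftBaseChange_of_galois_coordinates TC ?_ ?_ hsemi N hN s
      (fun i => 1 ⊗ₜ x i) (fun i => 1 ⊗ₜ y i) ?_ ?_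
    · exact tensorProduct_action_one TC hTC
    · exact fun c => exists_algebraMap_eq_sum_tensorProduct_action A hA TC hTC halg c
    · simp only [hTC, one_smul, Algebra.TensorProduct.tmul_mul_tmul, mul_one,
        ← TensorProduct.tmul_sum, hone, Algebra.TensorProduct.one_def]
    · intro g hg
      simp only [hTC, Algebra.TensorProduct.tmul_mul_tmul, mul_one,
        ← TensorProduct.tmul_sum, hne g hg, TensorProduct.tmul_zero]
  obtain ⟨hfin, hproj⟩ := finite_projective_tensorProduct_subalgebra (S := S) A halg
  obtain ⟨f, b, hfb⟩ := exists_linearMap_apply_eq_one (A := A) (B := B) Subtype.val_injective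
  have h := finite_projective_of_bijective_liftBaseChange N hbij
    (lTensorSubalgebraFunctional S A halg f) (1 ⊗ₜ b)
    (lTensorSubalgebraFunctional_one_tmul S A halg f b hfb)
  exact ⟨h.1, h.2, hbij⟩

/-- (étale / Galois descent, Berger–Colmez Prop. 2.2.1; following the
context, Banach algebras and completed tensor products over `ℚ_p` are replaced by
arbitrary commutative rings and plain tensor products).  Let `B` be a commutative ring
with an action of a finite group `G`, `A = B^G` its fixed subring, with `B` finite free
and faithfully flat over `A` and `B ⊗_A B ≅ ⊕_{g ∈ G} B·e_g` for orthogonal idempotents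
`e_g` with `g(e_h) = e_{gh}`.  Let `S` be a commutative ring with trivial `G`-action,
`C = S ⊗ B` (with `G` acting through `B`) and `M` a finite locally free (= finite
projective) `C`-module with a semilinear `G`-action.  Then `M^G` is a finite locally
free module over `D = S ⊗ A`, and the natural map `C ⊗_D M^G → M` is an isomorphism. -/
theorem galois_descent_fixed_points
    (S B : Type u) [CommRing S] [CommRing B]
    (G : Type u) [Group G] [Fintype G] [MulSemiringAction G B]
    (A : Subalgebra ℤ B) (hA : ∀ x : B, x ∈ A ↔ ∀ g : G, g • x = x)
    [Module.Finite (↥A) B] [Module.Free (↥A) B] [Module.FaithfullyFlat (↥A) B]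
    -- the action of `g ⊗ 1` on `B ⊗[A] B`
    (TB : G → ((B ⊗[↥A] B) →+* (B ⊗[↥A] B)))
    (hTB : ∀ (g : G) (x y : B), TB g (x ⊗ₜ[↥A] y) = (g • x) ⊗ₜ[↥A] y)
    -- the idempotent decomposition `B ⊗[A] B ≅ ⊕_g B·e_g`
    (e : G → (B ⊗[↥A] B))
    (hidem : ∀ g : G, e g * e g = e g)
    (horth : ∀ g h : G, g ≠ h → e g * e h = 0)
    (hbasis : ∀ x : B ⊗[↥A] B, ∃! cf : G → B,
      x = ∑ g : G, (cf g ⊗ₜ[↥A] (1 : B)) * e g)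
    (hGe : ∀ g h : G, TB g (e h) = e (g * h))
    -- the action of `1 ⊗ g` on `C = S ⊗ B`
    (TC : G → ((S ⊗[ℤ] B) →+* (S ⊗[ℤ] B)))
    (hTC : ∀ (g : G) (s : S) (b : B), TC g (s ⊗ₜ[ℤ] b) = s ⊗ₜ[ℤ] (g • b))
    -- a finite locally free `C`-module with semilinear `G`-action
    (M : Type u) [AddCommGroup M] [Module (S ⊗[ℤ] B) M]
    [Module.Finite (S ⊗[ℤ] B) M] [Module.Projective (S ⊗[ℤ] B) M]
    [DistribMulAction G M]
    (hsemi : ∀ (g : G) (x : S ⊗[ℤ] B) (m : M), g • (x • m) = TC g x • (g • m)) :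
    letI ι : (S ⊗[ℤ] ↥A) →+* (S ⊗[ℤ] B) :=
      (Algebra.TensorProduct.map (AlgHom.id ℤ S) A.val).toRingHom
    letI : Algebra (S ⊗[ℤ] ↥A) (S ⊗[ℤ] B) := ι.toAlgebra
    letI : Module (S ⊗[ℤ] ↥A) M := Module.compHom M ι
    letI : IsScalarTower (S ⊗[ℤ] ↥A) (S ⊗[ℤ] B) M :=
      ⟨fun d c m => by
        show (ι d * c) • m = ι d • (c • m)
        rw [mul_smul]⟩
    letI N : Submodule (S ⊗[ℤ] ↥A) M :=
      { carrier := {m : M | ∀ g : G, g • m = m}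
        add_mem' := by
          intro x y hx hy g
          rw [smul_add, hx g, hy g]
        zero_mem' := by intro g; rw [smul_zero]
        smul_mem' := by
          intro d m hm g
          have hfix : TC g (ι d) = ι d := by
            show TC g ((Algebra.TensorProduct.map (AlgHom.id ℤ S) A.val) d) = _
            induction d using TensorProduct.induction_on with
            | zero => simp
            | tmul s a =>
                simp only [Algebra.TensorProduct.map_tmul, AlgHom.coe_id, id_eq]
                rw [hTC g s (A.val a)]
                congr 1
                exact (hA (A.val a)).mp a.2 g
            | add x y hx hy => simp only [map_add, hx, hy]
          show g • (ι d • m) = ι d • m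
          rw [hsemi g (ι d) m, hm g, hfix] }
    Module.Finite (S ⊗[ℤ] ↥A) ↥N ∧
    Module.Projective (S ⊗[ℤ] ↥A) ↥N ∧
    Function.Bijective (LinearMap.liftBaseChange (S ⊗[ℤ] B) N.subtype) := by
  let ι : (S ⊗[ℤ] ↥A) →+* (S ⊗[ℤ] B) :=
    (Algebra.TensorProduct.map (AlgHom.id ℤ S) A.val).toRingHom
  let : Algebra (S ⊗[ℤ] ↥A) (S ⊗[ℤ] B) := ι.toAlgebra
  let : Module (S ⊗[ℤ] ↥A) M := Module.compHom M ι
  have : IsScalarTower (S ⊗[ℤ] ↥A) (S ⊗[ℤ] B) M := ⟨fun d c m => mul_smul (ι d) c m⟩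
  exact galois_descent_of_algebraMap_eq A hA TB hTB e hbasis hGe TC hTC hsemi (fun _ => rfl) _
    (fun _ => Iff.rfl)
end
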